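/- A finite group G is supersolvable if and only if all maximal chains of the Frattini subgroup Φ(G) in G have the same length. -/

import Mathlib

/-- A maximal chain of `H` in the ambient group of length `r`: a chain
`H = c 0 < c 1 < ... < c r = ⊤` where each `c i` is a maximal subgroup of `c (i+1)`,
i.e. each step is a covering relation in the subgroup lattice. -/
def IsMaxChainOf {G : Type*} [Group G] (H : Subgroup G) (r : ℕ) (c : ℕ → Subgroup G) : Prop :=
  c 0 = H ∧ c r = ⊤ ∧ ∀ i < r, c i ⋖ c (i + 1)

/-- All maximal chains of `H` in the ambient group have the same length. -/
def AllMaxChainsSameLength {G : Type*} [Group G] (H : Subgroup G) : Prop :=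
  ∀ (r s : ℕ) (c d : ℕ → Subgroup G),
    IsMaxChainOf H r c → IsMaxChainOf H s d → r = s


/-- A group is supersolvable if it has a normal series (all terms normal in the whole
group) with cyclic factors.  The factor `s (i+1) / s i` being cyclic is encoded as:
some single element `g` together with `s i` generates `s (i+1)`. -/
def IsSupersolvable (G : Type*) [Group G] : Prop :=
  ∃ (n : ℕ) (s : ℕ → Subgroup G), s 0 = ⊥ ∧ s n = ⊤ ∧ (∀ i, (s i).Normal) ∧
    ∀ i < n, ∃ g : G, s i ⊔ Subgroup.zpowers g = s (i + 1)


/-! ### Supersolvable groups -/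

section Supersolvable

variable {G H : Type*} [Group G] [Group H]

/-- A subgroup with cyclic image under `f` is generated by one element together with
its intersection with the kernel of `f`. -/
theorem Subgroup.exists_inf_ker_sup_zpowers_eq (f : G →* H) (L : Subgroup G)
    [IsCyclic (L.map f)] : ∃ g ∈ L, (f.ker ⊓ L) ⊔ Subgroup.zpowers g = L := by
  obtain ⟨⟨-, g, hg, rfl⟩, hgen⟩ := IsCyclic.exists_generator (α := L.map f)
  refine ⟨g, hg, le_antisymm (sup_le inf_le_right (Subgroup.zpowers_le.2 hg)) fun x hx ↦ ?_⟩
  obtain ⟨k, hk⟩ := Subgroup.mem_zpowers_iff.1 (hgen ⟨f x, Subgroup.mem_map_of_mem f hx⟩)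
  have hk' : f g ^ k = f x := by simpa using congrArg Subtype.val hk
  have : x * (g ^ k)⁻¹ ∈ f.ker ⊓ L :=
    ⟨by simp [hk'], L.mul_mem hx (L.inv_mem (L.zpow_mem hg k))⟩
  simpa using Subgroup.mul_mem_sup this (Subgroup.zpow_mem_zpowers g k)

theorem Subgroup.isCyclic_map_mk' {N L : Subgroup G} [N.Normal] {g : G}
    (h : N ⊔ Subgroup.zpowers g = L) : IsCyclic (L.map (QuotientGroup.mk' N)) := by
  rw [← h, Subgroup.map_sup, MonoidHom.map_zpowers, QuotientGroup.map_mk'_self, bot_sup_eq]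
  infer_instance

theorem Subgroup.index_eq_relIndex_of_sup_eq_top [Finite G] {T M : Subgroup G} [T.Normal]
    (h : T ⊔ M = ⊤) : M.index = M.relIndex T := by
  have key (K : Subgroup G) (hK : M ⊓ T ≤ K) :
      (M ⊓ T).relIndex K * Nat.card (M ⊓ T : Subgroup G) = Nat.card K := by
    simpa [mul_comm] using Subgroup.relIndex_mul_relIndex ⊥ (M ⊓ T) K bot_le hK
  have hT := key T inf_le_right
  have hM := key M inf_le_left
  have hidx := Subgroup.relIndex_sup_left (K := T) (H := M)
  rw [Subgroup.inf_relIndex_right] at hT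
  rw [Subgroup.inf_relIndex_left] at hM
  rw [h, Subgroup.relIndex_top_right] at hidx
  have hcard := M.index_mul_card
  rw [← T.index_mul_card, ← hT, ← hM, hidx] at hcard
  have hpos : 0 < T.index * Nat.card (M ⊓ T : Subgroup G) :=
    Nat.mul_pos (Nat.pos_of_ne_zero Subgroup.index_ne_zero_of_finite) Nat.card_pos
  refine Nat.eq_of_mul_eq_mul_right hpos ?_
  rw [hidx]
  linarith

namespace IsSupersolvable

theorem of_surjective (hG : IsSupersolvable G) (f : G →* H) (hf : Function.Surjective f) :
    IsSupersolvable H := by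
  obtain ⟨n, s, h0, hn, hs, hc⟩ := hG
  refine ⟨n, fun i ↦ (s i).map f, by simp [h0], ?_, fun i ↦ (hs i).map f hf, fun i hi ↦ ?_⟩
  · simp only [hn]
    exact Subgroup.map_top_of_surjective f hf
  · obtain ⟨g, hg⟩ := hc i hi
    exact ⟨f g, by simp only [← hg, Subgroup.map_sup, MonoidHom.map_zpowers]⟩

theorem subgroup (hG : IsSupersolvable G) (K : Subgroup G) : IsSupersolvable K := by
  obtain ⟨n, s, h0, hn, hs, hc⟩ := hG
  refine ⟨n, fun i ↦ (s i).subgroupOf K, by simp [h0], by simp [hn], fun i ↦ inferInstance,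
    fun i hi ↦ ?_⟩
  obtain ⟨g, hg⟩ := hc i hi
  have := Subgroup.isCyclic_map_mk' hg
  let f := (QuotientGroup.mk' (s i)).comp K.subtype
  have hle : ((s (i + 1)).subgroupOf K).map f ≤ (s (i + 1)).map (QuotientGroup.mk' (s i)) := by
    rw [← Subgroup.map_map]
    exact Subgroup.map_mono (Subgroup.map_comap_le _ _)
  have : IsCyclic (((s (i + 1)).subgroupOf K).map f) :=
    isCyclic_of_injective (Subgroup.inclusion hle) (Subgroup.inclusion_injective hle)
  obtain ⟨x, -, hx⟩ := Subgroup.exists_inf_ker_sup_zpowers_eq f ((s (i + 1)).subgroupOf K)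
  have hker : f.ker = (s i).subgroupOf K := by
    ext; simp [f, MonoidHom.mem_ker, Subgroup.mem_subgroupOf]
  refine ⟨x, ?_⟩
  rwa [hker, inf_eq_left.2] at hx
  exact Subgroup.comap_mono (le_sup_left.trans hg.le)

theorem of_quotient_zpowers {g : G} [(Subgroup.zpowers g).Normal]
    (h : IsSupersolvable (G ⧸ Subgroup.zpowers g)) : IsSupersolvable G := by
  obtain ⟨n, s, h0, hn, hs, hc⟩ := h
  let π := QuotientGroup.mk' (Subgroup.zpowers g)
  have hπ : Function.Surjective π := QuotientGroup.mk'_surjective _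
  have hker : π.ker = Subgroup.zpowers g := QuotientGroup.ker_mk' _
  refine ⟨n + 1, fun i ↦ Nat.casesOn i ⊥ fun i ↦ (s i).comap π, rfl, by simp [hn], ?_, ?_⟩
  · rintro (_ | i)
    · exact inferInstanceAs (⊥ : Subgroup G).Normal
    · exact (hs i).comap π
  · rintro (_ | i) hi
    · exact ⟨g, by simp [h0, hker]⟩
    · obtain ⟨y, hy⟩ := hc i (by omega)
      obtain ⟨x, rfl⟩ := hπ y
      refine ⟨x, ?_⟩
      simp only [← hy]
      refine Subgroup.map_injective_of_ker_le π ?_ ?_ ?_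
      · exact (Subgroup.ker_le_comap _ _).trans le_sup_left
      · exact Subgroup.ker_le_comap _ _
      · rw [Subgroup.map_sup, Subgroup.map_comap_eq_self_of_surjective hπ, MonoidHom.map_zpowers,
          Subgroup.map_comap_eq_self_of_surjective hπ]

theorem of_isCyclic [IsCyclic G] : IsSupersolvable G := by
  obtain ⟨g, hg⟩ := IsCyclic.exists_zpow_surjective (G := G)
  refine ⟨1, fun i ↦ if i = 0 then ⊥ else ⊤, by simp, by simp, fun i ↦ ?_, fun i hi ↦ ⟨g, ?_⟩⟩
  · dsimp only
    split_ifs <;> infer_instance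
  · obtain rfl : i = 0 := by omega
    simpa [Subgroup.eq_top_iff'] using fun x ↦ Subgroup.mem_zpowers_iff.2 (hg x)

/-- A nontrivial normal subgroup of a finite supersolvable group contains a normal subgroup
of prime order. -/
theorem exists_normal_le_card_prime [Finite G] (hG : IsSupersolvable G) {N : Subgroup G}
    [N.Normal] (hN : N ≠ ⊥) : ∃ A : Subgroup G, A.Normal ∧ A ≤ N ∧ (Nat.card A).Prime := by
  obtain ⟨n, s, h0, hn, hs, hc⟩ := hG
  have hex : ∃ i, s i ⊓ N ≠ ⊥ := ⟨n, by simpa [hn]⟩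
  classical
  obtain ⟨i, hi⟩ : ∃ i, Nat.find hex = i + 1 := by
    refine Nat.exists_eq_succ_of_ne_zero fun h ↦ Nat.find_spec hex ?_
    simp [h, h0]
  have hne : s (i + 1) ⊓ N ≠ ⊥ := hi ▸ Nat.find_spec hex
  have hbot : s i ⊓ N = ⊥ := by simpa using Nat.find_min hex (m := i) (by omega)
  have hin : i < n := by
    have := Nat.find_min' hex (m := n) (by simpa [hn])
    omega
  obtain ⟨g, hg⟩ := hc i hin
  have hcyc := Subgroup.isCyclic_map_mk' hg
  set C := s (i + 1) ⊓ N with hC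
  have hCn : C.Normal := inferInstance
  have : IsCyclic (C.map (QuotientGroup.mk' (s i))) :=
    isCyclic_of_injective (Subgroup.inclusion (Subgroup.map_mono inf_le_left))
      (Subgroup.inclusion_injective _)
  obtain ⟨c, hcC, hcg⟩ := Subgroup.exists_inf_ker_sup_zpowers_eq (QuotientGroup.mk' (s i)) C
  have hcz : C = Subgroup.zpowers c := by
    rw [← hcg, QuotientGroup.ker_mk', hC, ← inf_assoc, inf_right_comm, hbot, bot_inf_eq,
      bot_sup_eq]
  have hc1 : orderOf c ≠ 1 := fun h ↦ hne (by simpa [orderOf_eq_one_iff.1 h] using hcz)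
  obtain ⟨p, hp, d, hd⟩ := Nat.exists_prime_and_dvd hc1
  have ho : orderOf (c ^ d) = p := by
    have hd0 : d ≠ 0 := fun h ↦ (orderOf_pos c).ne' (by simp [hd, h])
    rw [orderOf_pow_of_dvd hd0 ⟨p, by rw [hd, mul_comm]⟩, hd]
    exact Nat.mul_div_cancel _ (Nat.pos_of_ne_zero hd0)
  refine ⟨Subgroup.zpowers (c ^ d), ⟨?_⟩, ?_, by rwa [Nat.card_zpowers, ho]⟩
  · rintro x hx a
    obtain ⟨k, rfl⟩ := Subgroup.mem_zpowers_iff.1 hx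
    have : a * c * a⁻¹ ∈ C := hCn.conj_mem c hcC a
    obtain ⟨m, hm⟩ := Subgroup.mem_zpowers_iff.1 (hcz ▸ this)
    refine Subgroup.mem_zpowers_iff.2 ⟨m * k, ?_⟩
    rw [← conj_zpow, ← conj_pow, ← hm]
    simp only [← zpow_natCast, ← zpow_mul]
    congr 1
    ring
  · exact (Subgroup.zpowers_le.2 (C.pow_mem hcC d)).trans inf_le_right

theorem exists_normal_lt_le_relIndex_prime [Finite G] (hG : IsSupersolvable G)
    {K N : Subgroup G} [K.Normal] [N.Normal] (hKN : K < N) :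
    ∃ T : Subgroup G, T.Normal ∧ K < T ∧ T ≤ N ∧ (K.relIndex T).Prime := by
  let π := QuotientGroup.mk' K
  have hπ : Function.Surjective π := QuotientGroup.mk'_surjective _
  have hker : π.ker = K := QuotientGroup.ker_mk' _
  have : (N.map π).Normal := Subgroup.Normal.map inferInstance π hπ
  obtain ⟨A, hA, hAN, hAp⟩ := (hG.of_surjective π hπ).exists_normal_le_card_prime
    (N := N.map π) (by rw [Ne, Subgroup.map_eq_bot_iff, hker]; exact hKN.not_ge)
  have hrel : K.relIndex (A.comap π) = Nat.card A := by
    have := Subgroup.relIndex_ker (K := A.comap π) π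
    rwa [hker, Subgroup.map_comap_eq_self_of_surjective hπ] at this
  refine ⟨A.comap π, hA.comap π, lt_of_le_of_ne ?_ fun h ↦ ?_, ?_, hrel ▸ hAp⟩
  · exact hker.symm.le.trans (Subgroup.ker_le_comap _ _)
  · rw [← h, Subgroup.relIndex_self] at hrel
    exact hAp.ne_one hrel.symm
  · refine (Subgroup.comap_mono hAN).trans ?_
    rw [Subgroup.comap_map_eq, hker, sup_eq_left.2 hKN.le]

theorem exists_normal_lt_relIndex_prime [Finite G] (hG : IsSupersolvable G) {N : Subgroup G}
    [hN : N.Normal] (hne : N ≠ ⊥) :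
    ∃ T : Subgroup G, T.Normal ∧ T < N ∧ (T.relIndex N).Prime := by
  obtain ⟨K, ⟨hK, hKN⟩, hmax⟩ := (Set.toFinite {K : Subgroup G | K.Normal ∧ K < N}).exists_maximal
    ⟨⊥, inferInstance, bot_lt_iff_ne_bot.2 hne⟩
  obtain ⟨T, hT, hKT, hTN, hp⟩ := hG.exists_normal_lt_le_relIndex_prime hKN
  obtain rfl | hlt := hTN.eq_or_lt
  · exact ⟨K, hK, hKN, hp⟩
  · exact absurd (hmax ⟨hT, hlt⟩ hKT.le) hKT.not_ge

/-- Maximal subgroups of a finite supersolvable group have prime index. -/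
theorem index_prime_of_isCoatom [Finite G] (hG : IsSupersolvable G) {M : Subgroup G}
    (hM : IsCoatom M) : M.index.Prime := by
  obtain ⟨T, hT, hKT, -, hp⟩ := hG.exists_normal_lt_le_relIndex_prime (K := M.normalCore)
    (N := ⊤) (lt_of_le_of_lt M.normalCore_le hM.lt_top)
  have hTM : ¬ T ≤ M := fun h ↦ hKT.not_ge ((Subgroup.normal_le_normalCore (N := T)).2 h)
  have htop : T ⊔ M = ⊤ := hM.2 _ (right_lt_sup.2 hTM)
  have hdvd : M.index ∣ M.normalCore.relIndex T := by
    rw [Subgroup.index_eq_relIndex_of_sup_eq_top htop, ← Subgroup.inf_relIndex_right]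
    exact Subgroup.relIndex_dvd_of_le_left _ (le_inf M.normalCore_le hKT.le)
  exact ((Nat.dvd_prime hp).1 hdvd).resolve_left (fun h ↦ hM.1 (Subgroup.index_eq_one.1 h)) ▸ hp

end IsSupersolvable

end Supersolvable

/-! ### Maximal chains between two elements of a partial order -/

section CoveringChain

/-- `CoveringChain r a b`: there is a chain of `r` covering relations from `a` to `b`. -/
inductive CoveringChain {α : Type*} [PartialOrder α] : ℕ → α → α → Prop
  | refl (a : α) : CoveringChain 0 a a
  | cons {r : ℕ} {a b c : α} (hab : a ⋖ b) (hbc : CoveringChain r b c) : CoveringChain (r + 1) a c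

namespace CoveringChain

variable {α β : Type*} [PartialOrder α] [PartialOrder β] {r s : ℕ} {a b c : α}

theorem trans (h : CoveringChain r a b) (h' : CoveringChain s b c) :
    CoveringChain (r + s) a c := by
  induction h with
  | refl => simpa using h'
  | cons hab _ ih => exact Nat.succ_add_eq_add_succ _ s ▸ cons hab (ih h')

theorem map {f : α → β} (hf : ∀ a b, a ⋖ b → f a ⋖ f b) (h : CoveringChain r a b) :
    CoveringChain r (f a) (f b) := by
  induction h with
  | refl => exact refl _
  | cons hab _ ih => exact cons (hf _ _ hab) ih

theorem of_seq (c : ℕ → α) (h : ∀ i < r, c i ⋖ c (i + 1)) : CoveringChain r (c 0) (c r) := by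
  induction r with
  | zero => exact refl _
  | succ r ih => exact (ih fun i hi ↦ h i (by omega)).trans (cons (h r (by omega)) (refl _))

theorem exists_seq (h : CoveringChain r a b) :
    ∃ c : ℕ → α, c 0 = a ∧ c r = b ∧ ∀ i < r, c i ⋖ c (i + 1) := by
  induction h with
  | refl a => exact ⟨fun _ ↦ a, rfl, rfl, by simp⟩
  | @cons r a b d hab _ ih =>
    obtain ⟨c, hc0, hcr, hc⟩ := ih
    refine ⟨fun i ↦ Nat.casesOn i a c, rfl, hcr, ?_⟩
    rintro (_ | i) hi
    · simpa [hc0] using hab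
    · exact hc i (by omega)

theorem exists_of_le [Finite α] (h : a ≤ b) : ∃ r, CoveringChain r a b := by
  induction a using WellFoundedGT.induction with
  | _ a ih =>
    obtain rfl | hlt := h.eq_or_lt
    · exact ⟨0, refl _⟩
    · obtain ⟨x, hax, hxb⟩ := exists_covBy_le_of_lt hlt
      obtain ⟨r, hr⟩ := ih x hax.lt hxb
      exact ⟨r + 1, cons hax hr⟩

end CoveringChain

/-- All maximal chains from `a` to `b` have the same length. -/
def EqualChainLengths {α : Type*} [PartialOrder α] (a b : α) : Prop :=
  ∀ r s, CoveringChain r a b → CoveringChain s a b → r = s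

theorem EqualChainLengths.of_le_of_le {α : Type*} [PartialOrder α] [Finite α] {a b x y : α}
    (h : EqualChainLengths a b) (hax : a ≤ x) (hyb : y ≤ b) : EqualChainLengths x y := by
  intro r s hr hs
  obtain ⟨m, hm⟩ := CoveringChain.exists_of_le hax
  obtain ⟨n, hn⟩ := CoveringChain.exists_of_le hyb
  have := h _ _ ((hm.trans hr).trans hn) ((hm.trans hs).trans hn)
  omega

theorem EqualChainLengths.of_map {α β : Type*} [PartialOrder α] [PartialOrder β] {f : α → β}
    (hf : ∀ a b, a ⋖ b → f a ⋖ f b) {a b : α} (h : EqualChainLengths (f a) (f b)) :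
    EqualChainLengths a b :=
  fun r s hr hs ↦ h r s (hr.map hf) (hs.map hf)

variable {G H : Type*} [Group G] [Group H]

theorem allMaxChainsSameLength_iff {K : Subgroup G} :
    AllMaxChainsSameLength K ↔ EqualChainLengths K ⊤ := by
  constructor
  · intro h r s hr hs
    obtain ⟨c, hc⟩ := hr.exists_seq
    obtain ⟨d, hd⟩ := hs.exists_seq
    exact h r s c d hc hd
  · rintro h r s c d ⟨hc0, hcr, hc⟩ ⟨hd0, hds, hd⟩
    refine h r s ?_ ?_
    · simpa [hc0, hcr] using CoveringChain.of_seq c hc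
    · simpa [hd0, hds] using CoveringChain.of_seq d hd

theorem Subgroup.comap_covBy_comap {f : G →* H} (hf : Function.Surjective f) {A B : Subgroup H}
    (h : A ⋖ B) : A.comap f ⋖ B.comap f := by
  refine ⟨(Subgroup.comap_lt_comap_of_surjective hf).2 h.lt, fun C hAC hCB ↦ ?_⟩
  have hC : (C.map f).comap f = C :=
    Subgroup.comap_map_eq_self ((Subgroup.ker_le_comap f A).trans hAC.le)
  rw [← hC] at hAC hCB
  exact h.2 ((Subgroup.comap_lt_comap_of_surjective hf).1 hAC)
    ((Subgroup.comap_lt_comap_of_surjective hf).1 hCB)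

theorem Subgroup.map_subtype_covBy {K : Subgroup G} {A B : Subgroup K} (h : A ⋖ B) :
    A.map K.subtype ⋖ B.map K.subtype := by
  refine ⟨Subgroup.map_lt_map_iff_of_injective K.subtype_injective |>.2 h.lt, fun C hAC hCB ↦ ?_⟩
  have hC : (C.subgroupOf K).map K.subtype = C :=
    Subgroup.map_subgroupOf_eq_of_le (hCB.le.trans (Subgroup.map_subtype_le B))
  rw [← hC] at hAC hCB
  exact h.2 ((Subgroup.map_lt_map_iff_of_injective K.subtype_injective).1 hAC)
    ((Subgroup.map_lt_map_iff_of_injective K.subtype_injective).1 hCB)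

theorem Subgroup.isCoatom_map_mk' {N M : Subgroup G} [N.Normal] (hNM : N ≤ M)
    (hM : IsCoatom M) : IsCoatom (M.map (QuotientGroup.mk' N)) := by
  have hπ := QuotientGroup.mk'_surjective N
  have hc : (M.map (QuotientGroup.mk' N)).comap (QuotientGroup.mk' N) = M :=
    Subgroup.comap_map_eq_self (by rwa [QuotientGroup.ker_mk'])
  refine ⟨fun h ↦ hM.1 (by rw [← hc, h, Subgroup.comap_top]), fun K hK ↦ ?_⟩
  rw [← Subgroup.comap_lt_comap_of_surjective hπ, hc] at hK
  rw [← Subgroup.map_comap_eq_self_of_surjective hπ K, hM.2 _ hK,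
    Subgroup.map_top_of_surjective _ hπ]

theorem EqualChainLengths.subgroup [Finite G]
    (h : EqualChainLengths (⊥ : Subgroup G) ⊤) (K : Subgroup G) :
    EqualChainLengths (⊥ : Subgroup K) ⊤ := by
  refine .of_map (f := Subgroup.map K.subtype) (fun _ _ ↦ Subgroup.map_subtype_covBy) ?_
  exact h.of_le_of_le bot_le le_top

theorem EqualChainLengths.quotient [Finite G] {K N : Subgroup G} [N.Normal]
    (h : EqualChainLengths K ⊤) (hKN : K ≤ N) :
    EqualChainLengths (⊥ : Subgroup (G ⧸ N)) ⊤ := by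
  refine .of_map (f := Subgroup.comap (QuotientGroup.mk' N))
    (fun _ _ ↦ Subgroup.comap_covBy_comap (QuotientGroup.mk'_surjective N)) ?_
  exact h.of_le_of_le (by simpa [MonoidHom.comap_bot]) le_top

/-- In a finite supersolvable group, every maximal chain from `A` to `B` has as many steps
as `|B : A|` has prime factors. -/
theorem CoveringChain.length_eq_cardFactors [Finite G] (hG : IsSupersolvable G) {r : ℕ}
    {A B : Subgroup G} (h : CoveringChain r A B) :
    A ≤ B ∧ r = ArithmeticFunction.cardFactors (A.relIndex B) := by
  induction h with
  | refl => simp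
  | @cons r A B C hAB _ ih =>
    obtain ⟨hBC, rfl⟩ := ih
    refine ⟨hAB.le.trans hBC, ?_⟩
    have hco : IsCoatom (A.subgroupOf B) := by
      rw [← covBy_top_iff]
      refine ⟨?_, fun K hK hKt ↦ ?_⟩
      · rw [lt_top_iff_ne_top, Ne, Subgroup.subgroupOf_eq_top]
        exact hAB.lt.not_ge
      · refine hAB.2 (c := K.map B.subtype) ?_ ?_
        · rw [← Subgroup.map_subgroupOf_eq_of_le hAB.le]
          exact (Subgroup.map_lt_map_iff_of_injective B.subtype_injective).2 hK
        · have := (Subgroup.map_lt_map_iff_of_injective B.subtype_injective).2 hKt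
          rw [← MonoidHom.range_eq_map, Subgroup.range_subtype] at this
          exact this
    have hp : (A.relIndex B).Prime := (hG.subgroup B).index_prime_of_isCoatom hco
    have : B.IsFiniteRelIndex C := Subgroup.isFiniteRelIndex_of_finiteIndex
    rw [← Subgroup.relIndex_mul_relIndex A B C hAB.le hBC,
      ArithmeticFunction.cardFactors_mul hp.ne_zero Subgroup.relIndex_ne_zero,
      ArithmeticFunction.cardFactors_apply_prime hp, add_comm]

theorem IsSupersolvable.equalChainLengths [Finite G] (hG : IsSupersolvable G)
    (A B : Subgroup G) : EqualChainLengths A B := fun _ _ hr hs ↦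
  (hr.length_eq_cardFactors hG).2.trans (hs.length_eq_cardFactors hG).2.symm

end CoveringChain

/-! ### Automorphisms induced on chief factors of prime order -/

section ChiefFactors

open scoped commutatorElement

variable {G : Type*} [Group G]

theorem Subgroup.mem_of_pow_mem_of_coprime {T : Subgroup G} {x : G} {a b : ℕ}
    (hab : a.Coprime b) (ha : x ^ a ∈ T) (hb : x ^ b ∈ T) : x ∈ T := by
  have h : x ^ ((a.gcd b : ℕ) : ℤ) = x := by simp [hab.gcd_eq_one]
  rw [← h, Nat.gcd_eq_gcd_ab, zpow_add, zpow_mul, zpow_mul, zpow_natCast, zpow_natCast]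
  exact T.mul_mem (T.zpow_mem ha _) (T.zpow_mem hb _)

theorem pow_mul_mul_inv_pow_of_commute {a b n : G} (h : a * b * a⁻¹ = n * b) (hn : Commute a n)
    (k : ℕ) : a ^ k * b * (a ^ k)⁻¹ = n ^ k * b := by
  induction k with
  | zero => simp
  | succ k ih =>
    calc a ^ (k + 1) * b * (a ^ (k + 1))⁻¹ = a * (a ^ k * b * (a ^ k)⁻¹) * a⁻¹ := by
          rw [pow_succ']; group
      _ = n ^ k * (a * b * a⁻¹) := by
          rw [ih, ← mul_assoc, (hn.pow_right k).eq]; group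
      _ = n ^ (k + 1) * b := by rw [h, pow_succ, mul_assoc]

/-- The action of `G` on a normal factor `L / K` of prime order `p` factors through a
homomorphism to `(ZMod p)ˣ`. -/
theorem Subgroup.exists_hom_units_zmod_of_relIndex_prime {K L : Subgroup G} [K.Normal] [L.Normal]
    {p : ℕ} (hp : p.Prime) (h : K.relIndex L = p) :
    ∃ θ : G →* (ZMod p)ˣ, ∀ g, θ g = 1 → ∀ x ∈ L, ⁅g, x⁆ ∈ K := by
  let π := QuotientGroup.mk' K
  have hπ : Function.Surjective π := QuotientGroup.mk'_surjective _
  have hker : π.ker = K := QuotientGroup.ker_mk' _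
  have hA : (L.map π).Normal := Subgroup.Normal.map inferInstance π hπ
  have hcard : Nat.card (L.map π) = p := by
    rw [← h, ← Subgroup.relIndex_ker, hker]
  have := Fact.mk hp
  have hcyc : IsCyclic (L.map π) := isCyclic_of_prime_card hcard
  subst hcard
  refine ⟨(IsCyclic.mulAutMulEquiv (L.map π)).toMonoidHom.comp (MulAut.conjNormal.comp π),
    fun g hg x hx ↦ ?_⟩
  have hg' : MulAut.conjNormal (H := L.map π) (π g) = 1 := by simpa using hg
  have := congrArg Subtype.val (DFunLike.congr_fun hg' ⟨π x, Subgroup.mem_map_of_mem π hx⟩)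
  rw [← hker, MonoidHom.mem_ker, map_commutatorElement, commutatorElement_def]
  simpa [mul_inv_eq_one] using this

/-- In a finite supersolvable group, an element of order prime to `p` which is killed by all
homomorphisms to `(ZMod p)ˣ` centralizes every normal `p`-subgroup. -/
theorem IsSupersolvable.commute_of_isPGroup [Finite G] (hG : IsSupersolvable G) {p : ℕ}
    [hp : Fact p.Prime] {U : Subgroup G} [U.Normal] (hU : IsPGroup p U) {h : G}
    (hθ : ∀ θ : G →* (ZMod p)ˣ, θ h = 1) (hcop : (orderOf h).Coprime p) {u : G} (hu : u ∈ U) :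
    Commute h u := by
  obtain ⟨K, ⟨hK, hKU⟩, hmin⟩ := (Set.toFinite
    {K : Subgroup G | K.Normal ∧ ∀ u ∈ U, ⁅h, u⁆ ∈ K}).exists_minimal
    ⟨⊤, inferInstance, fun _ _ ↦ Subgroup.mem_top _⟩
  suffices hbot : K = ⊥ by
    rw [← commutatorElement_eq_one_iff_commute, ← Subgroup.mem_bot, ← hbot]
    exact hKU u hu
  by_contra hne
  obtain ⟨T, hT, hTK, hq⟩ := hG.exists_normal_lt_relIndex_prime hne
  refine hTK.not_ge (hmin ⟨hT, fun u hu ↦ ?_⟩ hTK.le)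
  have hn := hKU u hu
  have hnq := Subgroup.pow_relIndex_mem (H := T) hn
  by_cases hqp : T.relIndex K = p
  · obtain ⟨θ, h1⟩ := Subgroup.exists_hom_units_zmod_of_relIndex_prime hp.out hqp
    have hc := h1 h (hθ θ) _ hn
    refine Subgroup.mem_of_pow_mem_of_coprime (hqp.symm ▸ hcop) ?_ hnq
    have key (x : G) : QuotientGroup.mk' T x = 1 ↔ x ∈ T := QuotientGroup.eq_one_iff x
    rw [← key, map_commutatorElement, commutatorElement_eq_one_iff_commute] at hc
    have := pow_mul_mul_inv_pow_of_commute (b := QuotientGroup.mk' T u)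
      (by rw [← map_inv, ← map_mul, ← map_mul, ← map_mul, commutatorElement_def]; simp) hc
      (orderOf h)
    rw [← map_pow, pow_orderOf_eq_one, ← map_pow] at this
    rw [← key]
    simpa using this
  · have hnU : ⁅h, u⁆ ∈ U := by
      rw [commutatorElement_def]
      exact U.mul_mem (Subgroup.Normal.conj_mem inferInstance u hu h) (U.inv_mem hu)
    obtain ⟨k, hk⟩ := hU ⟨_, hnU⟩
    have hk' : ⁅h, u⁆ ^ p ^ k = 1 := by simpa using congrArg Subtype.val hk
    refine Subgroup.mem_of_pow_mem_of_coprime ?_ (hk' ▸ T.one_mem) hnq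
    exact ((Nat.coprime_primes hp.out hq).2 (Ne.symm hqp)).pow_left k

end ChiefFactors

/-! ### Groups whose maximal subgroups have prime index -/

section Huppert

open scoped commutatorElement

variable {G : Type*} [Group G]

/-- If all maximal subgroups have prime index, the Sylow subgroup for the largest prime divisor
of the order is normal. -/
theorem Sylow.normal_of_forall_isCoatom_index_prime [Finite G]
    (hG : ∀ M : Subgroup G, IsCoatom M → M.index.Prime) {p : ℕ} [hp : Fact p.Prime]
    (hmax : ∀ q : ℕ, q.Prime → q ∣ Nat.card G → q ≤ p) (P : Sylow p G) :
    (P : Subgroup G).Normal := by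
  rw [← Subgroup.normalizer_eq_top_iff]
  obtain h | ⟨M, hM, hPM⟩ := eq_top_or_exists_le_coatom (Subgroup.normalizer (P : Set G))
  · exact h
  exfalso
  have hle : (P : Subgroup G) ≤ M := Subgroup.le_normalizer.trans hPM
  have h1 := card_sylow_modEq_one p M
  rw [Sylow.card_eq_index_normalizer (P.subtype hle)] at h1
  have h2 := card_sylow_modEq_one p G
  rw [Sylow.card_eq_index_normalizer P, ← Subgroup.relIndex_mul_index hPM] at h2
  have h3 : (Subgroup.normalizer (P : Set G)).relIndex M =
      (Subgroup.normalizer ((P.subtype hle : Subgroup M) : Set M)).index := by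
    rw [P.coe_subtype]
    exact congrArg Subgroup.index (Subgroup.subgroupOf_normalizer_eq hle)
  rw [h3] at h2
  have hq := hG M hM
  have h4 : M.index ≡ 1 [MOD p] := by
    simpa using (h1.symm.mul_right M.index).trans h2
  obtain hlt | heq := (hmax _ hq M.index_dvd_card).lt_or_eq
  · exact hq.ne_one (h4.eq_of_lt_of_lt hlt hp.out.one_lt)
  · rw [heq] at h4
    have := (Nat.modEq_zero_iff_dvd.2 dvd_rfl).symm.trans h4
    exact zero_ne_one (this.eq_of_lt_of_lt hp.out.pos hp.out.one_lt)

/-- Minimal normal subgroups. -/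
structure Subgroup.IsMinimalNormal (N : Subgroup G) : Prop where
  normal : N.Normal
  ne_bot : N ≠ ⊥
  eq_of_le : ∀ K : Subgroup G, K.Normal → K ≤ N → K ≠ ⊥ → K = N

theorem Subgroup.exists_isMinimalNormal_le [Finite G] {K : Subgroup G} (hK : K.Normal)
    (hne : K ≠ ⊥) : ∃ N : Subgroup G, N.IsMinimalNormal ∧ N ≤ K := by
  obtain ⟨N, ⟨h1, h2, h3⟩, hmin⟩ := (Set.toFinite
    {N : Subgroup G | N.Normal ∧ N ≠ ⊥ ∧ N ≤ K}).exists_minimal ⟨K, hK, hne, le_rfl⟩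
  exact ⟨N, ⟨h1, h2, fun L hL hLN hne ↦ le_antisymm hLN (hmin ⟨hL, hne, hLN.trans h3⟩ hLN)⟩, h3⟩

theorem IsSupersolvable.of_quotient_of_isCyclic {N : Subgroup G} [N.Normal] [hN : IsCyclic N]
    (h : IsSupersolvable (G ⧸ N)) : IsSupersolvable G := by
  obtain ⟨g, rfl⟩ := (Subgroup.isCyclic_iff_exists_zpowers_eq_top N).1 hN
  exact h.of_quotient_zpowers

/-- A minimal normal subgroup is central in every normal `p`-subgroup containing it. -/
theorem Subgroup.IsMinimalNormal.le_centralizer [Finite G] {N X : Subgroup G}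
    (hN : N.IsMinimalNormal) {p : ℕ} [hp : Fact p.Prime] (hX : IsPGroup p X) [X.Normal]
    (hNX : N ≤ X) : N ≤ Subgroup.centralizer X := by
  have := hN.normal
  rw [← hN.eq_of_le (N ⊓ Subgroup.centralizer X) inferInstance inf_le_left]
  · exact inf_le_right
  let _ : MulAction X N := MulAction.compHom N ((MulAut.conjNormal (H := N)).comp X.subtype)
  have hsmul (x : X) (n : N) : ((x • n : N) : G) = x * n * (x : G)⁻¹ := rfl
  have hdvd : p ∣ Nat.card N := (hX.to_le hNX).card_eq_or_dvd.resolve_left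
    fun h ↦ hN.ne_bot (Subgroup.card_eq_one.1 h)
  obtain ⟨n, hn, hn1⟩ := hX.exists_fixed_point_of_prime_dvd_card_of_fixed_point N hdvd (a := 1)
    (fun x ↦ Subtype.ext (by simp [hsmul]))
  refine fun hbot ↦ hn1 (Subtype.ext (Eq.symm ?_))
  rw [Subgroup.coe_one, ← Subgroup.mem_bot, ← hbot]
  refine ⟨n.2, Subgroup.mem_centralizer_iff.2 fun x hx ↦ ?_⟩
  rw [← mul_inv_eq_iff_eq_mul, ← hsmul ⟨x, hx⟩, hn]

theorem Subgroup.IsMinimalNormal.isCyclic_of_disjoint [Finite G] {N Q : Subgroup G}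
    (hN : N.IsMinimalNormal) [Q.Normal] (hNQ : Disjoint N Q) (hQ : IsSupersolvable (G ⧸ Q)) :
    IsCyclic N := by
  have := hN.normal
  let π := QuotientGroup.mk' Q
  have hπ : Function.Surjective π := QuotientGroup.mk'_surjective _
  have hker : π.ker = Q := QuotientGroup.ker_mk' _
  have hnorm : (N.map π).Normal := Subgroup.Normal.map hN.normal π hπ
  obtain ⟨A, hA, hAN, hAp⟩ := hQ.exists_normal_le_card_prime (N := N.map π) (by
    rw [Ne, Subgroup.map_eq_bot_iff, hker]
    exact fun h ↦ hN.ne_bot (hNQ.eq_bot_of_le h))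
  have hle : N ≤ A.comap π := by
    rw [← hN.eq_of_le (N ⊓ A.comap π) inferInstance inf_le_left]
    · exact inf_le_right
    intro hbot
    have hA1 : A = ⊥ := by
      rw [eq_bot_iff]
      intro a ha
      obtain ⟨n, hn, rfl⟩ := hAN ha
      have : n ∈ N ⊓ A.comap π := ⟨hn, ha⟩
      rw [hbot, Subgroup.mem_bot] at this
      simp [this]
    exact hAp.ne_one (by simp [hA1])
  have := Fact.mk hAp
  have hAc : IsCyclic A := isCyclic_of_prime_card rfl
  let f : N →* A := (π.comp N.subtype).codRestrict A fun n ↦ hle n.2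
  refine isCyclic_of_injective f ((injective_iff_map_eq_one f).2 fun n hn ↦ Subtype.ext ?_)
  have hn' : (n : G) ∈ Q := by
    rw [← hker]
    exact congrArg Subtype.val hn
  exact Subgroup.disjoint_def.1 hNQ n.2 hn'

theorem Subgroup.IsMinimalNormal.isCyclic_of_isCoatom [Finite G] {N M : Subgroup G}
    (hN : N.IsMinimalNormal) (hcomm : N ≤ Subgroup.centralizer N) (hM : IsCoatom M)
    (hp : M.index.Prime) (hNM : ¬ N ≤ M) : IsCyclic N := by
  have := hN.normal
  have htop : N ⊔ M = ⊤ := hM.2 _ (right_lt_sup.2 hNM)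
  have hnorm : (M ⊓ N).Normal := by
    rw [← Subgroup.normalizer_eq_top_iff, eq_top_iff, ← htop, sup_le_iff]
    constructor
    · intro n hn
      rw [Subgroup.mem_normalizer_iff]
      intro x
      constructor
      · intro hx
        rw [← Subgroup.mem_centralizer_iff.1 (hcomm hn) x hx.2, mul_inv_cancel_right]
        exact hx
      · intro hx
        have := Subgroup.mem_centralizer_iff.1 (hcomm hn) _ hx.2
        have hx' : x = n * x * n⁻¹ := by simpa [mul_assoc] using this
        rwa [hx']
    · exact le_trans (le_inf Subgroup.le_normalizer
        (Subgroup.normalizer_eq_top_iff.2 hN.normal ▸ le_top))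
        (Subgroup.inf_normalizer_le_normalizer_inf)
  have hbot : M ⊓ N = ⊥ := by
    by_contra hne
    exact hNM (hN.eq_of_le _ hnorm inf_le_right hne ▸ inf_le_left)
  have := Fact.mk hp
  refine isCyclic_of_prime_card (p := M.index) ?_
  rw [Subgroup.index_eq_relIndex_of_sup_eq_top htop, ← Subgroup.inf_relIndex_right, hbot,
    Subgroup.relIndex_bot_left]

/-- A maximal normal `p`-subgroup contains its centralizer, if there are no nontrivial normal
`q`-subgroups for `q ≠ p`. -/
theorem IsSupersolvable.centralizer_le_of_isPGroup [Finite G] (hG : IsSupersolvable G) {p : ℕ}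
    [hp : Fact p.Prime] {P : Subgroup G} [hPn : P.Normal] (hP : IsPGroup p P)
    (hmax : ∀ Q : Subgroup G, Q.Normal → IsPGroup p Q → Q ≤ P)
    (hq : ∀ q : ℕ, q.Prime → q ≠ p → ∀ Q : Subgroup G, Q.Normal → IsPGroup q Q → Q = ⊥) :
    Subgroup.centralizer P ≤ P := by
  set C := Subgroup.centralizer (P : Set G) with hC
  have hCn : C.Normal := Subgroup.normal_centralizer
  by_contra hle
  have hlt : C ⊓ P < C := inf_lt_left.2 hle
  obtain ⟨T, hT, hZT, hTC, hr⟩ := hG.exists_normal_lt_le_relIndex_prime hlt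
  have hpow {x : G} (hx : x ∈ T) : x ^ (C ⊓ P).relIndex T ∈ P :=
    (Subgroup.pow_relIndex_mem (C ⊓ P) hx).2
  have hTP : ¬ T ≤ P := fun h ↦ hZT.not_ge (le_inf hTC h)
  by_cases hrp : (C ⊓ P).relIndex T = p
  · refine hTP (hmax T hT fun x ↦ ?_)
    obtain ⟨k, hk⟩ := hP ⟨_, hpow x.2⟩
    refine ⟨k + 1, Subtype.ext ?_⟩
    have := congrArg Subtype.val hk
    simpa [hrp, ← pow_mul, pow_succ'] using this
  · set r := (C ⊓ P).relIndex T
    have hrF := Fact.mk hr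
    obtain ⟨t, ht, htP⟩ := SetLike.not_le_iff_exists.1 hTP
    obtain ⟨k, hk⟩ := hP ⟨_, hpow ht⟩
    replace hk : (t ^ r) ^ p ^ k = 1 := congrArg Subtype.val hk
    set z := t ^ p ^ k with hz
    have hzr : z ^ r = 1 := by rw [hz, ← pow_mul, mul_comm, pow_mul, hk]
    have hzT : z ∈ T := T.pow_mem ht _
    have hcop : (p ^ k).Coprime r := ((Nat.coprime_primes hp.out hr).2 (Ne.symm hrp)).pow_left k
    have hzP : z ∉ P := fun h ↦ htP (Subgroup.mem_of_pow_mem_of_coprime hcop h (hpow ht))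
    have hTle : T ≤ (C ⊓ P) ⊔ Subgroup.zpowers z := by
      have hle : (C ⊓ P) ⊔ Subgroup.zpowers z ≤ T := sup_le hZT.le (Subgroup.zpowers_le.2 hzT)
      have hmul := Subgroup.relIndex_mul_relIndex _ _ _ (le_sup_left (a := C ⊓ P)) hle
      obtain h1 | h1 := (Nat.dvd_prime hr).1 (Dvd.intro _ hmul)
      · rw [Subgroup.relIndex_eq_one, sup_le_iff, Subgroup.zpowers_le] at h1
        exact absurd h1.2.2 hzP
      · rw [h1] at hmul
        exact Subgroup.relIndex_eq_one.1 (Nat.eq_of_mul_eq_mul_left hr.pos (by simpa using hmul))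
    have hzn : (Subgroup.zpowers z).Normal := by
      refine ⟨fun a ha g ↦ ?_⟩
      have har : a ^ r = 1 := by
        obtain ⟨i, rfl⟩ := Subgroup.mem_zpowers_iff.1 ha
        rw [← zpow_natCast, ← zpow_mul, mul_comm, zpow_mul, zpow_natCast, hzr, one_zpow]
      have haT := hTle (hT.conj_mem a (Subgroup.zpowers_le.2 hzT ha) g)
      obtain ⟨c, hc, b, hb, hcb⟩ := Subgroup.mem_sup_of_normal_left.1 haT
      obtain ⟨i, rfl⟩ := Subgroup.mem_zpowers_iff.1 hb
      have hcomm : Commute c (z ^ i) :=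
        Subgroup.mem_centralizer_iff.1 (C.zpow_mem (hTC hzT) i) c hc.2
      have hcr : c ^ r = 1 := by
        have : (c * z ^ i) ^ r = 1 := by rw [hcb, conj_pow, har]; group
        rwa [hcomm.mul_pow, ← zpow_natCast (z ^ i), ← zpow_mul, mul_comm i, zpow_mul, zpow_natCast,
          hzr, one_zpow, mul_one] at this
      obtain ⟨j, hj⟩ := hP ⟨c, hc.2⟩
      replace hj : c ^ p ^ j = 1 := congrArg Subtype.val hj
      have hc1 : c = 1 := by
        rw [← Subgroup.mem_bot]
        exact Subgroup.mem_of_pow_mem_of_coprime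
          (((Nat.coprime_primes hp.out hr).2 (Ne.symm hrp)).pow_left j) (by simp [hj])
          (by simp [hcr])
      rw [← hcb, hc1, one_mul]
      exact hb
    have hz1 := hq r hr hrp _ hzn (.of_card_dvd_pow (n := 1) (by
      rw [Nat.card_zpowers, pow_one]
      exact orderOf_dvd_of_pow_eq_one hzr))
    rw [Subgroup.zpowers_eq_bot] at hz1
    exact hzP (hz1 ▸ P.one_mem)

theorem IsSupersolvable.isPGroup_iInf_ker [Finite G] (hG : IsSupersolvable G) {p : ℕ}
    [hp : Fact p.Prime] {P : Subgroup G} [hPn : P.Normal] (hP : IsPGroup p P)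
    (hC : Subgroup.centralizer P ≤ P) :
    IsPGroup p (⨅ θ : G →* (ZMod p)ˣ, θ.ker : Subgroup G) := by
  rintro ⟨y, hy⟩
  have hy' (θ : G →* (ZMod p)ˣ) : θ y = 1 := (Subgroup.mem_iInf.1 hy θ)
  obtain ⟨k, m, hm, hkm⟩ := Nat.exists_eq_pow_mul_and_not_dvd (orderOf_pos y).ne' p hp.out.ne_one
  have ho : orderOf (y ^ p ^ k) = m := by
    rw [orderOf_pow_of_dvd (pow_ne_zero _ hp.out.ne_zero) (hkm ▸ dvd_mul_right _ _), hkm,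
      Nat.mul_div_cancel_left _ (pow_pos hp.out.pos _)]
  have hcop : (orderOf (y ^ p ^ k)).Coprime p := by
    rw [ho]
    exact ((Nat.Prime.coprime_iff_not_dvd hp.out).2 hm).symm
  have hmem : y ^ p ^ k ∈ P := hC <| Subgroup.mem_centralizer_iff.2 fun u hu ↦
    (hG.commute_of_isPGroup hP (fun θ ↦ by simp [hy' θ]) hcop hu).eq.symm
  obtain ⟨j, hj⟩ := hP ⟨_, hmem⟩
  refine ⟨k + j, Subtype.ext ?_⟩
  simpa [← pow_mul, ← pow_add] using congrArg Subtype.val hj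

theorem Module.End.exists_hasEigenvector_of_iterate_eq {V : Type*} [AddCommGroup V] {p : ℕ}
    [hp : Fact p.Prime] [Module (ZMod p) V] [Finite V] [Nontrivial V]
    (T : Module.End (ZMod p) V) (hT : ∀ v, T^[p - 1] v = v) : ∃ a v, T.HasEigenvector a v := by
  have hT1 : T ^ p - T = 0 := by
    have : T ^ (p - 1) = 1 := by
      ext x
      rw [Module.End.pow_apply, hT]
      rfl
    rw [← pow_sub_one_mul hp.out.ne_zero, this, one_mul, sub_self]
  have hdvd : minpoly (ZMod p) T ∣ Polynomial.X ^ p - Polynomial.X :=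
    minpoly.dvd _ _ (by simpa using hT1)
  have hsplit : (minpoly (ZMod p) T).Splits := by
    refine Polynomial.Splits.of_dvd ?_
      (FiniteField.X_pow_card_sub_X_ne_zero (ZMod p) hp.out.one_lt) hdvd
    rw [Polynomial.splits_iff_card_roots, FiniteField.X_pow_card_sub_X_natDegree_eq _ hp.out.one_lt]
    have := FiniteField.roots_X_pow_card_sub_X (ZMod p)
    rw [ZMod.card] at this
    rw [this]
    simp
  have : Module.Finite (ZMod p) V := Module.Finite.of_finite
  obtain ⟨a, ha⟩ := hsplit.exists_eval_eq_zero
    (minpoly.degree_pos (Algebra.IsIntegral.isIntegral T)).ne'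
  exact ⟨a, (Module.End.hasEigenvalue_of_isRoot ha).exists_hasEigenvector⟩

/-- An automorphism with `f ^ (p - 1) = 1` of a nontrivial group of exponent `p` has
an eigenvector. -/
theorem MulAut.exists_apply_eq_pow {N : Type*} [CommGroup N] [Finite N] [Nontrivial N] {p : ℕ}
    [hp : Fact p.Prime] (hN : ∀ x : N, x ^ p = 1) (f : MulAut N) (hf : f ^ (p - 1) = 1) :
    ∃ (x : N) (k : ℕ), x ≠ 1 ∧ f x = x ^ k := by
  let _ : Module (ZMod p) (Additive N) := AddCommGroup.zmodModule fun x ↦ hN x.toMul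
  obtain ⟨a, v, hv⟩ := Module.End.exists_hasEigenvector_of_iterate_eq
    (f.toMonoidHom.toAdditive.toZModLinearMap p) (fun v ↦ by
      have (k : ℕ) (x : N) : f^[k] x = (f ^ k) x := by
        induction k with
        | zero => rfl
        | succ k ih => rw [Function.iterate_succ_apply', ih, pow_succ', MulAut.mul_apply]
      have h := this (p - 1) v.toMul
      rw [hf] at h
      exact h)
  refine ⟨v.toMul, a.val, hv.2, ?_⟩
  have h1 := hv.apply_eq_smul
  rw [← ZMod.natCast_zmod_val a, Nat.cast_smul_eq_nsmul] at h1
  exact h1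

theorem Subgroup.IsMinimalNormal.isCyclic_of_centralizer [Finite G] {N : Subgroup G}
    (hN : N.IsMinimalNormal) {p : ℕ} [hp : Fact p.Prime] (hNp : IsPGroup p N)
    (hcomm : ∀ a b : G, ⁅a, b⁆ ∈ Subgroup.centralizer (N : Set G))
    (hpow : ∀ a : G, a ^ (p - 1) ∈ Subgroup.centralizer (N : Set G)) : IsCyclic N := by
  have := hN.normal
  have hNc := hN.le_centralizer hNp le_rfl
  have hc {x y : G} (hx : x ∈ N) (hy : y ∈ N) : Commute x y :=
    Subgroup.mem_centralizer_iff.1 (hNc hy) x hx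
  let _ : CommGroup N :=
    { (inferInstance : Group N) with mul_comm := fun a b ↦ Subtype.ext (hc a.2 b.2) }
  have hnt : Nontrivial N := (Subgroup.nontrivial_iff_ne_bot N).2 hN.ne_bot
  have hexp (x : N) : x ^ p = 1 := by
    let E : Subgroup G :=
      { carrier := {x | x ∈ N ∧ x ^ p = 1}
        one_mem' := by simp
        mul_mem' := fun {x y} hx hy ↦
          ⟨N.mul_mem hx.1 hy.1, by rw [(hc hx.1 hy.1).mul_pow, hx.2, hy.2, one_mul]⟩
        inv_mem' := fun {x} hx ↦ ⟨N.inv_mem hx.1, by rw [inv_pow, hx.2, inv_one]⟩ }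
    have hE : E.Normal := ⟨fun x hx g ↦ ⟨hN.normal.conj_mem x hx.1 g, by
      rw [conj_pow, hx.2]; group⟩⟩
    obtain ⟨y, hy⟩ := exists_prime_orderOf_dvd_card' p (hNp.card_eq_or_dvd.resolve_left
      Finite.one_lt_card.ne')
    have hEN : E = N := by
      refine hN.eq_of_le E hE (fun x hx ↦ hx.1) fun hbot ↦ ?_
      have : (y : G) ∈ E := ⟨y.2, by rw [← Subgroup.coe_pow, ← hy, pow_orderOf_eq_one]; rfl⟩
      rw [hbot, Subgroup.mem_bot, OneMemClass.coe_eq_one] at this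
      rw [this, orderOf_one] at hy
      exact hp.out.ne_one hy.symm
    exact Subtype.ext (hEN.symm.le x.2).2
  have heig (g : G) : ∃ k : ℕ, ∀ x ∈ N, g * x * g⁻¹ = x ^ k := by
    obtain ⟨x, k, hx1, hx⟩ := MulAut.exists_apply_eq_pow hexp (MulAut.conjNormal g) (by
      rw [← map_pow]
      ext x
      rw [MulAut.conjNormal_apply, MulAut.one_apply,
        ← Subgroup.mem_centralizer_iff.1 (hpow g) x x.2, mul_inv_cancel_right])
    refine ⟨k, ?_⟩
    let E : Subgroup G :=
      { carrier := {x | x ∈ N ∧ g * x * g⁻¹ = x ^ k}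
        one_mem' := by simp
        mul_mem' := fun {x y} hx hy ↦
          ⟨N.mul_mem hx.1 hy.1, by rw [← conj_mul, hx.2, hy.2, (hc hx.1 hy.1).mul_pow]⟩
        inv_mem' := fun {x} hx ↦ ⟨N.inv_mem hx.1, by rw [← conj_inv, hx.2, inv_pow]⟩ }
    have hE : E.Normal := by
      refine ⟨fun x hx h ↦ ⟨hN.normal.conj_mem x hx.1 h, ?_⟩⟩
      have hmem : h * (g * x * g⁻¹) * h⁻¹ ∈ N :=
        hN.normal.conj_mem _ (hN.normal.conj_mem x hx.1 g) h
      calc g * (h * x * h⁻¹) * g⁻¹ = ⁅g, h⁆ * (h * (g * x * g⁻¹) * h⁻¹) * ⁅g, h⁆⁻¹ := by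
            rw [commutatorElement_def]; group
        _ = h * (g * x * g⁻¹) * h⁻¹ := by
            rw [← Subgroup.mem_centralizer_iff.1 (hcomm g h) _ hmem, mul_inv_cancel_right]
        _ = (h * x * h⁻¹) ^ k := by rw [hx.2, conj_pow]
    have hEN : E = N := by
      refine hN.eq_of_le E hE (fun x hx ↦ hx.1) fun hbot ↦ hx1 ?_
      have : (x : G) ∈ E := ⟨x.2, congrArg Subtype.val hx⟩
      rwa [hbot, Subgroup.mem_bot, OneMemClass.coe_eq_one] at this
    exact fun x hx ↦ (hEN.symm.le hx).2
  obtain ⟨x, hx⟩ := exists_ne (1 : N)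
  have hzN : Subgroup.zpowers (x : G) = N := by
    refine hN.eq_of_le _ ⟨fun y hy g ↦ ?_⟩ (Subgroup.zpowers_le.2 x.2) (by simpa using hx)
    obtain ⟨k, hk⟩ := heig g
    rw [hk y (Subgroup.zpowers_le.2 x.2 hy)]
    exact Subgroup.pow_mem _ hy k
  rw [← hzN]
  infer_instance

theorem Subgroup.card_quotient_lt [Finite G] {K : Subgroup G} (hK : K ≠ ⊥) :
    Nat.card (G ⧸ K) < Nat.card G := by
  rw [K.card_eq_card_quotient_mul_card_subgroup]
  exact lt_mul_of_one_lt_right Nat.card_pos (K.one_lt_card_iff_ne_bot.2 hK)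

theorem Subgroup.exists_sylow_sup_eq [Finite G] {N L : Subgroup G} [N.Normal] (hNL : N ≤ L)
    {q k : ℕ} [hq : Fact q.Prime] (h : N.relIndex L = q ^ k) (Q : Sylow q L) :
    (Q : Subgroup L).map L.subtype ⊔ N = L := by
  have hle : (Q : Subgroup L).map L.subtype ⊔ N ≤ L := sup_le (Subgroup.map_subtype_le _) hNL
  refine le_antisymm hle (Subgroup.relIndex_eq_one.1 ?_)
  have h1 : ((Q : Subgroup L).map L.subtype ⊔ N).relIndex L ∣ q ^ k :=
    h ▸ Subgroup.relIndex_dvd_of_le_left L le_sup_right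
  have h2 : ((Q : Subgroup L).map L.subtype ⊔ N).relIndex L ∣ (Q : Subgroup L).index := by
    refine (Subgroup.relIndex_dvd_of_le_left L le_sup_left).trans (dvd_of_eq ?_)
    rw [Subgroup.relIndex, Subgroup.subgroupOf,
      Subgroup.comap_map_eq_self_of_injective L.subtype_injective]
  refine Nat.eq_one_of_dvd_coprimes (Nat.Coprime.pow_left k ?_) h1 h2
  exact (Nat.Prime.coprime_iff_not_dvd hq.out).2 Q.not_dvd_index

theorem Subgroup.IsMinimalNormal.isCyclic_of_le_isCoatom [Finite G] {N : Subgroup G}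
    (hN : N.IsMinimalNormal) [N.Normal] {p : ℕ} [hp : Fact p.Prime] (hNp : IsPGroup p N)
    (hNM : ∀ M : Subgroup G, IsCoatom M → N ≤ M)
    (hquot : ∀ K : Subgroup G, ∀ _ : K.Normal, K ≠ ⊥ → IsSupersolvable (G ⧸ K)) : IsCyclic N := by
  let π := QuotientGroup.mk' N
  have hπ : Function.Surjective π := QuotientGroup.mk'_surjective _
  have hker : π.ker = N := QuotientGroup.ker_mk' _
  have hS := hquot N hN.normal hN.ne_bot
  by_cases hB : ∃ q : ℕ, q.Prime ∧ q ≠ p ∧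
    ∃ Q : Subgroup (G ⧸ N), Q.Normal ∧ IsPGroup q Q ∧ Q ≠ ⊥
  · obtain ⟨q, hq, hqp, Q', hQn, hQ, hQne⟩ := hB
    have := Fact.mk hq
    have hNL : N ≤ Q'.comap π := hker.symm.le.trans (Subgroup.ker_le_comap _ _)
    obtain ⟨k, hk⟩ := IsPGroup.iff_card.1 hQ
    have hrel : N.relIndex (Q'.comap π) = q ^ k := by
      have := Subgroup.relIndex_ker (K := Q'.comap π) π
      rwa [hker, Subgroup.map_comap_eq_self_of_surjective hπ, hk] at this
    let Q : Sylow q (Q'.comap π) := default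
    have hsup := Subgroup.exists_sylow_sup_eq hNL hrel Q
    have hfrat := Sylow.normalizer_sup_eq_top Q
    set Q₁ := (Q : Subgroup (Q'.comap π)).map (Q'.comap π).subtype
    have hQ₁ : Q₁.Normal := by
      rw [← Subgroup.normalizer_eq_top_iff]
      obtain h | ⟨M, hM, hPM⟩ := eq_top_or_exists_le_coatom (Subgroup.normalizer (Q₁ : Set G))
      · exact h
      · refine absurd ?_ hM.1
        rw [eq_top_iff, ← hfrat, ← hsup]
        exact sup_le hPM (sup_le (Subgroup.le_normalizer.trans hPM) (hNM M hM))
    have hQ₁ne : Q₁ ≠ ⊥ := by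
      intro h
      rw [h, bot_sup_eq] at hsup
      refine hQne ?_
      rw [← Subgroup.map_comap_eq_self_of_surjective hπ Q', ← hsup]
      exact QuotientGroup.map_mk'_self N
    exact hN.isCyclic_of_disjoint
      (IsPGroup.disjoint_of_ne p q (Ne.symm hqp) _ _ hNp (Q.isPGroup'.map _)) (hquot Q₁ hQ₁ hQ₁ne)
  · push Not at hB
    obtain ⟨P, ⟨hPn, hP⟩, hPmax⟩ := (Set.toFinite
      {P : Subgroup (G ⧸ N) | P.Normal ∧ IsPGroup p P}).exists_maximal
      ⟨⊥, inferInstance, IsPGroup.of_bot⟩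
    have hC := hS.centralizer_le_of_isPGroup hP (fun Q hQ hQp ↦ le_sup_left.trans
      (hPmax ⟨inferInstance, hQp.to_sup_of_normal_right hP⟩ le_sup_right)) hB
    have hX := hS.isPGroup_iInf_ker hP hC
    set X := (⨅ θ : (G ⧸ N) →* (ZMod p)ˣ, θ.ker : Subgroup (G ⧸ N))
    have hXn : X.Normal := Subgroup.normal_iInf_normal fun _ ↦ inferInstance
    have hX' : IsPGroup p (X.comap π) := hX.comap_of_ker_isPGroup π (hker.symm ▸ hNp)
    have hle := Subgroup.le_centralizer_iff.1
      (hN.le_centralizer hX' (hker.symm.le.trans (Subgroup.ker_le_comap _ _)))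
    refine hN.isCyclic_of_centralizer hNp (fun a b ↦ hle ?_) (fun a ↦ hle ?_)
    · refine Subgroup.mem_comap.2 (Subgroup.mem_iInf.2 fun θ ↦ ?_)
      rw [MonoidHom.mem_ker, map_commutatorElement, map_commutatorElement,
        commutatorElement_eq_one_iff_mul_comm, mul_comm]
    · refine Subgroup.mem_comap.2 (Subgroup.mem_iInf.2 fun θ ↦ ?_)
      rw [MonoidHom.mem_ker, map_pow, map_pow, ZMod.units_pow_card_sub_one_eq_one]

/-- **Huppert's theorem**: a finite group all of whose maximal subgroups have prime index is
supersolvable. -/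
theorem IsSupersolvable.of_forall_isCoatom_index_prime [Finite G]
    (hG : ∀ M : Subgroup G, IsCoatom M → M.index.Prime) : IsSupersolvable G := by
  induction h : Nat.card G using Nat.strong_induction_on generalizing G with
  | _ n ih =>
  obtain _ | _ := subsingleton_or_nontrivial G
  · exact .of_isCyclic
  have hquot (K : Subgroup G) (hKn : K.Normal) (hK : K ≠ ⊥) : IsSupersolvable (G ⧸ K) := by
    refine ih _ (h ▸ Subgroup.card_quotient_lt hK) (fun M hM ↦ ?_) rfl
    have hπ := QuotientGroup.mk'_surjective K
    rw [← Subgroup.index_comap_of_surjective M hπ]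
    exact hG _ (Subgroup.isCoatom_comap_of_surjective hπ hM)
  have hpf : (Nat.card G).primeFactors.Nonempty :=
    Nat.nonempty_primeFactors.2 Finite.one_lt_card
  set p := (Nat.card G).primeFactors.max' hpf
  have hp' : p ∈ (Nat.card G).primeFactors := Finset.max'_mem _ hpf
  have hp : Fact p.Prime := ⟨Nat.prime_of_mem_primeFactors hp'⟩
  let P : Sylow p G := default
  have hPn := P.normal_of_forall_isCoatom_index_prime hG fun q hq hdvd ↦
    Finset.le_max' _ q (Nat.mem_primeFactors.2 ⟨hq, hdvd, Nat.card_pos.ne'⟩)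
  obtain ⟨N, hN, hNP⟩ := Subgroup.exists_isMinimalNormal_le hPn
    (P.ne_bot_of_dvd_card (Nat.dvd_of_mem_primeFactors hp'))
  have hNp : IsPGroup p N := P.isPGroup'.to_le hNP
  have := hN.normal
  have hcyc : IsCyclic N := by
    by_cases hM : ∀ M : Subgroup G, IsCoatom M → N ≤ M
    · exact hN.isCyclic_of_le_isCoatom hNp hM hquot
    · push Not at hM
      obtain ⟨M, hM, hNM⟩ := hM
      exact hN.isCyclic_of_isCoatom (hN.le_centralizer hNp le_rfl) hM (hG M hM) hNM
  exact (hquot N hN.normal hN.ne_bot).of_quotient_of_isCyclic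

end Huppert

/-! ### Fusion -/

section Fusion

open scoped commutatorElement Pointwise

variable {G : Type*} [Group G] {p : ℕ}

/-- Every element of order prime to `p` normalizing a `p`-subgroup centralizes it. -/
def CentralizesPSubgroups (p : ℕ) (G : Type*) [Group G] : Prop :=
  ∀ U : Subgroup G, IsPGroup p U → ∀ h ∈ Subgroup.normalizer (U : Set G),
    (orderOf h).Coprime p → h ∈ Subgroup.centralizer (U : Set G)

theorem CentralizesPSubgroups.exists_mul_eq [Finite G] [hp : Fact p.Prime]
    (hG : CentralizesPSubgroups p G) {D : Subgroup G} (hD : IsPGroup p D)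
    (S : Sylow p (Subgroup.normalizer (D : Set G))) (n : Subgroup.normalizer (D : Set G)) :
    ∃ c : Subgroup.normalizer (D : Set G), (c : G) ∈ Subgroup.centralizer (D : Set G) ∧
      ∃ s ∈ S, c * s = n := by
  set C := (Subgroup.centralizer (D : Set G)).subgroupOf (Subgroup.normalizer (D : Set G))
  have hC : C.Normal := Subgroup.normal_subgroupOf_centralizer_normalizer _
  have hquot : IsPGroup p (Subgroup.normalizer (D : Set G) ⧸ C) := by
    intro x
    obtain ⟨y, rfl⟩ := QuotientGroup.mk_surjective x
    obtain ⟨k, m, hm, hkm⟩ := Nat.exists_eq_pow_mul_and_not_dvd (orderOf_pos (y : G)).ne' p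
      hp.out.ne_one
    refine ⟨k, ?_⟩
    rw [← QuotientGroup.mk_pow, QuotientGroup.eq_one_iff, Subgroup.mem_subgroupOf,
      Subgroup.coe_pow]
    refine hG D hD _ (Subgroup.pow_mem _ y.2 _) ?_
    rw [orderOf_pow_of_dvd (pow_ne_zero _ hp.out.ne_zero) (hkm ▸ dvd_mul_right _ _), hkm,
      Nat.mul_div_cancel_left _ (pow_pos hp.out.pos _)]
    exact ((Nat.Prime.coprime_iff_not_dvd hp.out).2 hm).symm
  have htop : C ⊔ (S : Subgroup (Subgroup.normalizer (D : Set G))) = ⊤ := by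
    obtain ⟨k, hk⟩ := IsPGroup.iff_card.1 hquot
    have hCS := Subgroup.index_dvd_of_le
      (le_sup_left : C ≤ C ⊔ (S : Subgroup (Subgroup.normalizer (D : Set G))))
    rw [Subgroup.index_eq_card C, hk] at hCS
    refine Subgroup.index_eq_one.1 (Nat.eq_one_of_dvd_coprimes (Nat.Coprime.pow_left k ?_) hCS
      (Subgroup.index_dvd_of_le le_sup_right))
    exact (Nat.Prime.coprime_iff_not_dvd hp.out).2 S.not_dvd_index
  obtain ⟨c, hc, s, hs, h⟩ := Subgroup.mem_sup_of_normal_left.1 (htop.symm.le (Subgroup.mem_top n))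
  exact ⟨c, hc, s, hs, h⟩

theorem IsPGroup.lt_inf_normalizer [Finite G] [hp : Fact p.Prime] {P D : Subgroup G}
    (hP : IsPGroup p P) (hDP : D < P) : D < P ⊓ Subgroup.normalizer (D : Set G) := by
  have := hP.isNilpotent
  have hlt := Group.normalizerCondition_of_isNilpotent (G := P) (D.subgroupOf P) (by
    rw [lt_top_iff_ne_top, Ne, Subgroup.subgroupOf_eq_top]
    exact hDP.not_ge)
  rw [← Subgroup.subgroupOf_normalizer_eq hDP.le] at hlt
  refine lt_of_le_of_ne (le_inf hDP.le Subgroup.le_normalizer) fun h ↦ hlt.ne ?_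
  conv_lhs => rw [h]
  rw [inf_comm, Subgroup.inf_subgroupOf_right]

theorem CentralizesPSubgroups.exists_smul_eq [Finite G] [hp : Fact p.Prime]
    (hG : CentralizesPSubgroups p G) (P Q : Sylow p G) :
    ∃ c ∈ Subgroup.centralizer ((P ⊓ Q : Subgroup G) : Set G), c • P = Q := by
  induction h : (P ⊓ Q : Subgroup G) using WellFoundedGT.induction generalizing P Q with
  | _ D ih =>
  by_cases hPQ : P = Q
  · exact ⟨1, Subgroup.one_mem _, by rw [one_smul, hPQ]⟩
  have hDP : D < P := h ▸ inf_lt_left.2 fun hle ↦ hPQ (Sylow.ext (P.is_maximal' Q.2 hle).symm)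
  have hDQ : D < Q := h ▸ inf_lt_right.2 fun hle ↦ hPQ (Sylow.ext (Q.is_maximal' P.2 hle))
  have hlP := P.isPGroup'.lt_inf_normalizer hDP
  have hlQ := Q.isPGroup'.lt_inf_normalizer hDQ
  have hDp : IsPGroup p D := P.isPGroup'.to_le hDP.le
  obtain ⟨S, hS⟩ := (P.isPGroup'.comap_subtype
    (K := Subgroup.normalizer (D : Set G))).exists_le_sylow
  obtain ⟨T, hT⟩ := (Q.isPGroup'.comap_subtype
    (K := Subgroup.normalizer (D : Set G))).exists_le_sylow
  obtain ⟨n, rfl⟩ := MulAction.exists_smul_eq (Subgroup.normalizer (D : Set G)) S T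
  obtain ⟨c, hc, s, hs, rfl⟩ := hG.exists_mul_eq hDp S n
  obtain ⟨R, hR⟩ := (S.isPGroup'.map
    (Subgroup.normalizer (D : Set G)).subtype).exists_le_sylow
  have h1 : D < (P ⊓ R : Subgroup G) := by
    refine hlP.trans_le (le_inf inf_le_left fun x hx ↦ hR ⟨⟨x, hx.2⟩, hS hx.1, rfl⟩)
  have h2 : D < (((c : G) • R : Sylow p G) ⊓ Q : Subgroup G) := by
    refine hlQ.trans_le (le_inf (fun x hx ↦ ?_) inf_le_left)
    have hx' : (⟨x, hx.2⟩ : Subgroup.normalizer (D : Set G)) ∈ (c * s) • S := hT hx.1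
    rw [mul_smul, Sylow.smul_eq_iff_mem_normalizer.2 (Subgroup.le_normalizer hs)] at hx'
    change _ ∈ ((c • S : Sylow p (Subgroup.normalizer (D : Set G))) :
      Subgroup (Subgroup.normalizer (D : Set G))) at hx'
    rw [Sylow.coe_subgroup_smul, Subgroup.mem_pointwise_smul_iff_inv_smul_mem] at hx'
    rw [Sylow.coe_subgroup_smul, Subgroup.mem_pointwise_smul_iff_inv_smul_mem]
    exact hR ⟨_, hx', rfl⟩
  obtain ⟨a, ha, haR⟩ := ih _ h1 P R rfl
  obtain ⟨b, hb, hbQ⟩ := ih _ h2 _ Q rfl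
  refine ⟨b * c * a, Subgroup.mul_mem _ (Subgroup.mul_mem _ ?_ hc) ?_, ?_⟩
  · exact Subgroup.centralizer_le h2.le hb
  · exact Subgroup.centralizer_le h1.le ha
  · rw [mul_smul, mul_smul, haR, hbQ]

theorem CentralizesPSubgroups.commutator_ne_top [Finite G] [hp : Fact p.Prime]
    (hG : CentralizesPSubgroups p G) (hdvd : p ∣ Nat.card G) : commutator G ≠ ⊤ := by
  intro htop
  let P : Sylow p G := default
  have hne : Nontrivial P := (Subgroup.nontrivial_iff_ne_bot _).2 (P.ne_bot_of_dvd_card hdvd)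
  have hPn : (P : Subgroup G) = Subgroup.focalSubgroup P := by
    rw [← Subgroup.commutator_inf_eq_focalSubgroup, htop, top_inf_eq]
  have := P.isPGroup'.isNilpotent
  have hlt := Group.IsSolvable.commutator_lt_top_of_nontrivial P
  refine hlt.ne (Subgroup.map_injective (P : Subgroup G).subtype_injective ?_)
  rw [Subgroup.map_subtype_commutator, ← MonoidHom.range_eq_map, Subgroup.range_subtype]
  refine le_antisymm (Subgroup.commutator_le_self _) (hPn.le.trans ?_)
  rw [Subgroup.focalSubgroup_def, Subgroup.closure_le]
  rintro - ⟨hg, x, hx, u, rfl⟩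
  have hy : u * x * u⁻¹ ∈ (P : Subgroup G) := by
    convert mul_mem (inv_mem hg) hx using 1
    group
  obtain ⟨c, hc, hcP⟩ := hG.exists_smul_eq (u⁻¹ • P) P
  have hcx : x * c = c * x := by
    refine Subgroup.mem_centralizer_iff.1 hc x ⟨?_, hx⟩
    change x ∈ (↑(u⁻¹ • P) : Subgroup G)
    rw [Sylow.coe_subgroup_smul, Subgroup.mem_pointwise_smul_iff_inv_smul_mem]
    simpa [MulAut.smul_def] using hy
  rw [← mul_smul, Sylow.smul_eq_iff_mem_normalizer] at hcP
  obtain ⟨d, hd, s, hs, hds⟩ := hG.exists_mul_eq P.isPGroup' (P.subtype Subgroup.le_normalizer)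
    ⟨c * u⁻¹, hcP⟩
  have hdx := Subgroup.mem_centralizer_iff.1 hd x hx
  have hu : u = (s : G)⁻¹ * (d : G)⁻¹ * c := by
    have h := congrArg (Subtype.val) hds
    rw [Subgroup.coe_mul] at h
    rw [← mul_inv_rev, h]
    group
  have hxu : u * x * u⁻¹ = (s : G)⁻¹ * x * s := by
    calc u * x * u⁻¹ = (s : G)⁻¹ * (d : G)⁻¹ * (c * x) * c⁻¹ * d * s := by rw [hu]; group
      _ = (s : G)⁻¹ * (d : G)⁻¹ * (x * d) * s := by rw [← hcx]; group
      _ = (s : G)⁻¹ * x * s := by rw [hdx]; group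
  have hcomm : ⁅x, u⁆ = ⁅x, (s : G)⁻¹⁆ := by
    calc ⁅x, u⁆ = x * (u * x * u⁻¹)⁻¹ := by group
      _ = ⁅x, (s : G)⁻¹⁆ := by rw [hxu]; group
  rw [hcomm]
  exact Subgroup.commutator_mem_commutator hx (inv_mem hs)

end Fusion

/-! ### Groups all of whose maximal chains have the same length -/

theorem IsSupersolvable.commute_of_isPGroup_minFac {G : Type*} [Group G] [Finite G]
    (hG : IsSupersolvable G) {p : ℕ} [hp : Fact p.Prime]
    (hmin : ∀ q : ℕ, q.Prime → q ∣ Nat.card G → p ≤ q) {U : Subgroup G} [U.Normal]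
    (hU : IsPGroup p U) {h u : G} (hcop : (orderOf h).Coprime p) (hu : u ∈ U) : Commute h u := by
  refine hG.commute_of_isPGroup hU (fun θ ↦ ?_) hcop hu
  rw [← orderOf_eq_one_iff]
  by_contra hne
  obtain ⟨q, hq, hqd⟩ := Nat.exists_prime_and_dvd hne
  have h1 := hmin q hq ((hqd.trans (orderOf_map_dvd θ h)).trans (orderOf_dvd_natCard h))
  have h2 := Nat.le_of_dvd (by have := hp.out.two_le; omega)
    ((hqd.trans (orderOf_dvd_card (x := θ h))).trans (ZMod.card_units p).dvd)
  have := hp.out.two_le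
  omega

theorem CentralizesPSubgroups.of_isSimpleGroup {G : Type*} [Group G] [Finite G] [IsSimpleGroup G]
    (hG : ∀ K : Subgroup G, K ≠ ⊤ → IsSupersolvable K) {p : ℕ} [hp : Fact p.Prime]
    (hmin : ∀ q : ℕ, q.Prime → q ∣ Nat.card G → p ≤ q) : CentralizesPSubgroups p G := by
  intro U hU h hh hcop
  rw [Subgroup.mem_centralizer_iff]
  intro u hu
  by_cases htop : Subgroup.normalizer (U : Set G) = ⊤
  · rcases (Subgroup.normalizer_eq_top_iff.1 htop).eq_bot_or_eq_top with rfl | rfl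
    · rw [Subgroup.mem_bot.1 hu, one_mul, mul_one]
    · obtain ⟨k, hk⟩ := IsPGroup.iff_orderOf.1 hU ⟨h, Subgroup.mem_top h⟩
      rw [Subgroup.orderOf_mk] at hk
      have : orderOf h = 1 := Nat.eq_one_of_dvd_coprimes (hcop.pow_right k) dvd_rfl hk.dvd
      rw [orderOf_eq_one_iff.1 this, one_mul, mul_one]
  · have := (hG _ htop).commute_of_isPGroup_minFac (p := p)
      (fun q hq hqd ↦ hmin q hq (hqd.trans (Subgroup.card_subgroup_dvd_card _)))
      (U := U.subgroupOf (Subgroup.normalizer (U : Set G))) hU.comap_subtype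
      (h := ⟨h, hh⟩) (u := ⟨u, Subgroup.le_normalizer hu⟩)
      (by rwa [Subgroup.orderOf_mk]) hu
    exact (congrArg Subtype.val this.eq).symm

theorem IsSupersolvable.of_isSimpleGroup {G : Type*} [Group G] [Finite G] [IsSimpleGroup G]
    (hG : ∀ K : Subgroup G, K ≠ ⊤ → IsSupersolvable K) : IsSupersolvable G := by
  have hp : Fact (Nat.card G).minFac.Prime :=
    ⟨Nat.minFac_prime (Finite.one_lt_card (α := G)).ne'⟩
  have hne := (CentralizesPSubgroups.of_isSimpleGroup hG
    fun q hq hqd ↦ Nat.minFac_le_of_dvd hq.two_le hqd).commutator_ne_top (Nat.minFac_dvd _)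
  have hbot := (inferInstance : (commutator G).Normal).eq_bot_or_eq_top.resolve_right hne
  have hcomm : ∀ a b : G, a * b = b * a := fun a b ↦ by
    rw [← commutatorElement_eq_one_iff_mul_comm, ← Subgroup.mem_bot, ← hbot]
    exact Subgroup.commutator_mem_commutator (Subgroup.mem_top a) (Subgroup.mem_top b)
  obtain ⟨x, hx⟩ := exists_ne (1 : G)
  have hn : (Subgroup.zpowers x).Normal :=
    ⟨fun n hn g ↦ by rwa [hcomm g n, mul_inv_cancel_right]⟩
  have htop := hn.eq_bot_or_eq_top.resolve_left (Subgroup.zpowers_ne_bot.2 hx)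
  have : IsCyclic G := ⟨x, fun g ↦ htop.symm.le (Subgroup.mem_top g)⟩
  exact .of_isCyclic

theorem EqualChainLengths.index_prime {G : Type*} [Group G] [Finite G]
    (hG : EqualChainLengths (⊥ : Subgroup G) ⊤) {M M' : Subgroup G} (hM : IsCoatom M)
    (hM' : IsCoatom M') (hMs : IsSupersolvable M) (hMs' : IsSupersolvable M')
    (hp : M'.index.Prime) : M.index.Prime := by
  have key : ∀ K : Subgroup G, IsCoatom K → IsSupersolvable K →
      CoveringChain (ArithmeticFunction.cardFactors (Nat.card K) + 1) (⊥ : Subgroup G) ⊤ := by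
    intro K hK hKs
    obtain ⟨r, hr⟩ := CoveringChain.exists_of_le (bot_le : (⊥ : Subgroup K) ≤ ⊤)
    have hlen := (hr.length_eq_cardFactors hKs).2
    rw [Subgroup.relIndex_top_right, Subgroup.index_bot] at hlen
    have := hr.map (f := Subgroup.map K.subtype) fun _ _ ↦ Subgroup.map_subtype_covBy
    rw [Subgroup.map_bot, ← MonoidHom.range_eq_map, Subgroup.range_subtype, hlen] at this
    exact this.trans (.cons hK.covBy_top (.refl _))
  have h := hG _ _ (key M hM hMs) (key M' hM' hMs')
  rw [← ArithmeticFunction.cardFactors_eq_one_iff_prime] at hp ⊢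
  have h1 := congrArg ArithmeticFunction.cardFactors (M.card_mul_index.trans M'.card_mul_index.symm)
  rw [ArithmeticFunction.cardFactors_mul Nat.card_pos.ne' Subgroup.index_ne_zero_of_finite,
    ArithmeticFunction.cardFactors_mul Nat.card_pos.ne' Subgroup.index_ne_zero_of_finite] at h1
  omega

theorem Subgroup.card_lt_of_ne_top {G : Type*} [Group G] [Finite G] {K : Subgroup G}
    (hK : K ≠ ⊤) : Nat.card K < Nat.card G :=
  lt_of_le_of_ne (Subgroup.card_le_card_group K) fun h ↦ hK (Subgroup.card_eq_iff_eq_top K |>.1 h)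

/-- **Iwasawa's theorem**. -/
theorem IsSupersolvable.of_equalChainLengths {G : Type*} [Group G] [Finite G]
    (hG : EqualChainLengths (⊥ : Subgroup G) ⊤) : IsSupersolvable G := by
  induction h : Nat.card G using Nat.strong_induction_on generalizing G with
  | _ n ih =>
  subst h
  have hsub : ∀ K : Subgroup G, K ≠ ⊤ → IsSupersolvable K := fun K hK ↦
    ih _ (Subgroup.card_lt_of_ne_top hK) (hG.subgroup K) rfl
  rcases subsingleton_or_nontrivial G with hs | hs
  · exact .of_isCyclic
  by_cases hsimple : ∀ N : Subgroup G, N.Normal → N = ⊥ ∨ N = ⊤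
  · have : IsSimpleGroup G := ⟨hsimple⟩
    exact .of_isSimpleGroup hsub
  push Not at hsimple
  obtain ⟨N, hN, hbot, htop⟩ := hsimple
  have hq : IsSupersolvable (G ⧸ N) :=
    ih _ (Subgroup.card_quotient_lt hbot) (hG.quotient bot_le) rfl
  have : Nontrivial (G ⧸ N) := QuotientGroup.nontrivial_iff.2 htop
  obtain ⟨M, hM⟩ := IsCoatomic.exists_coatom (Subgroup (G ⧸ N))
  have hM' := Subgroup.isCoatom_comap_of_surjective (QuotientGroup.mk'_surjective N) hM
  have hp := hq.index_prime_of_isCoatom hM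
  rw [← Subgroup.index_comap_of_surjective _ (QuotientGroup.mk'_surjective N)] at hp
  exact of_forall_isCoatom_index_prime fun K hK ↦
    hG.index_prime hK hM' (hsub _ hK.1) (hsub _ hM'.1) hp

theorem stmt_4 {G : Type*} [Group G] [Finite G] :
    IsSupersolvable G ↔ AllMaxChainsSameLength (frattini G) := by
  rw [allMaxChainsSameLength_iff]
  refine ⟨fun hG ↦ hG.equalChainLengths _ _, fun hG ↦ ?_⟩
  have hq : IsSupersolvable (G ⧸ frattini G) := .of_equalChainLengths (hG.quotient le_rfl)
  refine .of_forall_isCoatom_index_prime fun M hM ↦ ?_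
  have hle := frattini_le_coatom hM
  have hp := hq.index_prime_of_isCoatom (Subgroup.isCoatom_map_mk' hle hM)
  rwa [Subgroup.index_map_eq _ (QuotientGroup.mk'_surjective _)
    (by rwa [QuotientGroup.ker_mk'])] at hp
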